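/- Let n ≥ 1, let D₁ = diag(x₁, …, xₙ) with real entries x₁ > x₂ > ⋯ > xₙ > 0, and let D₂ = diag(y₁, …, yₙ) with real entries 0 < y₁ < y₂ < ⋯ < yₙ. Suppose h₁ = D₁·M₁·D₁⁻¹ and h₂ = D₂·M₂·D₂⁻¹ where M₁, M₂ ∈ U(n) are complex unitary matrices. If h₁*·h₁ = h₂*·h₂ (where * denotes conjugate transpose), then h₁ and h₂ are diagonal matrices whose diagonal entries are complex numbers of modulus 1. -/

import Mathlib

open Matrix

section Aux

variable {ι : Type*} [Fintype ι]

/-- If a weighted sum with weights at most `1` dominates the total mass, the mass vanishes wherever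
the weight is not `1`. -/
theorem eq_zero_of_sum_le_sum_mul {w p : ι → ℝ} (hle : ∀ i, w i * p i ≤ p i)
    (hsum : ∑ i, p i ≤ ∑ i, w i * p i) {i : ι} (hi : w i ≠ 1) : p i = 0 := by
  have h := (Finset.sum_eq_sum_iff_of_le fun i _ => hle i).1
    (le_antisymm (Finset.sum_le_sum fun i _ => hle i) hsum) i (Finset.mem_univ i)
  exact (mul_left_eq_self₀.1 h).resolve_left hi

theorem eq_zero_of_sum_mul_le_sum {w p : ι → ℝ} (hle : ∀ i, p i ≤ w i * p i)
    (hsum : ∑ i, w i * p i ≤ ∑ i, p i) {i : ι} (hi : w i ≠ 1) : p i = 0 := by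
  have h := (Finset.sum_eq_sum_iff_of_le fun i _ => hle i).1
    (le_antisymm (Finset.sum_le_sum fun i _ => hle i) hsum) i (Finset.mem_univ i)
  exact (mul_left_eq_self₀.1 h.symm).resolve_left hi

theorem conjTranspose_mul_self_apply_diag (A : Matrix ι ι ℂ) (k : ι) :
    (Aᴴ * A) k k = ((∑ i, ‖A i k‖ ^ 2 : ℝ) : ℂ) := by
  simp [Matrix.mul_apply, Complex.conj_mul']

variable [DecidableEq ι]

theorem sum_norm_sq_col_eq_one {M : Matrix ι ι ℂ} (hM : Mᴴ * M = 1) (k : ι) :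
    ∑ i, ‖M i k‖ ^ 2 = 1 := by
  have h := conjTranspose_mul_self_apply_diag M k
  rw [hM, Matrix.one_apply_eq] at h
  exact_mod_cast h.symm

theorem norm_diag_eq_one_of_col {M : Matrix ι ι ℂ} (hM : Mᴴ * M = 1) {k : ι}
    (hcol : ∀ j, j ≠ k → M j k = 0) : ‖M k k‖ = 1 := by
  have h := sum_norm_sq_col_eq_one hM k
  rw [Finset.sum_eq_single k (fun j _ hj => by simp [hcol j hj]) (by simp)] at h
  exact (pow_eq_one_iff_of_nonneg (norm_nonneg _) two_ne_zero).1 h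

theorem row_eq_zero_of_col {M : Matrix ι ι ℂ} (hM : Mᴴ * M = 1) {k : ι}
    (hcol : ∀ j, j ≠ k → M j k = 0) {j : ι} (hj : j ≠ k) : M k j = 0 := by
  have h := congrFun (congrFun hM k) j
  rw [Matrix.mul_apply, Matrix.one_apply_ne hj.symm,
    Finset.sum_eq_single k (fun i _ hi => by simp [hcol i hi]) (by simp)] at h
  refine (mul_eq_zero.1 h).resolve_left fun h0 => ?_
  have h1 := norm_diag_eq_one_of_col hM hcol
  rw [Matrix.conjTranspose_apply, star_eq_zero] at h0
  simp [h0] at h1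

theorem diagonal_conj_apply (x : ι → ℝ) (hx : ∀ j, 0 < x j) (M : Matrix ι ι ℂ) (j k : ι) :
    (Matrix.diagonal (fun j => (x j : ℂ)) * M * (Matrix.diagonal (fun j => (x j : ℂ)))⁻¹) j k =
      ((x j / x k : ℝ) : ℂ) * M j k := by
  have hinv : (Matrix.diagonal (fun j => (x j : ℂ)))⁻¹ =
      Matrix.diagonal (fun j => (x j : ℂ)⁻¹) := by
    refine Matrix.inv_eq_right_inv ?_
    rw [Matrix.diagonal_mul_diagonal, ← Matrix.diagonal_one]
    congr 1
    funext i
    exact mul_inv_cancel₀ (Complex.ofReal_ne_zero.2 (hx i).ne')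
  rw [hinv, Matrix.mul_diagonal, Matrix.diagonal_mul]
  push_cast
  ring

end Aux

theorem stmt_17 (n : ℕ) (hn : 1 ≤ n) (x y : Fin n → ℝ)
    (hx : StrictAnti x) (hxpos : ∀ j, 0 < x j)
    (hy : StrictMono y) (hypos : ∀ j, 0 < y j)
    (M₁ M₂ h₁ h₂ : Matrix (Fin n) (Fin n) ℂ)
    (hM₁ : M₁ᴴ * M₁ = 1) (hM₂ : M₂ᴴ * M₂ = 1)
    (hh₁ : h₁ = Matrix.diagonal (fun j => (x j : ℂ)) * M₁ *
      (Matrix.diagonal (fun j => (x j : ℂ)))⁻¹)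
    (hh₂ : h₂ = Matrix.diagonal (fun j => (y j : ℂ)) * M₂ *
      (Matrix.diagonal (fun j => (y j : ℂ)))⁻¹)
    (heq : h₁ᴴ * h₁ = h₂ᴴ * h₂) :
    ((∀ j k : Fin n, j ≠ k → h₁ j k = 0) ∧ (∀ j : Fin n, ‖h₁ j j‖ = 1)) ∧
    ((∀ j k : Fin n, j ≠ k → h₂ j k = 0) ∧ (∀ j : Fin n, ‖h₂ j j‖ = 1)) := by
  have hx' := diagonal_conj_apply x hxpos M₁
  have hy' := diagonal_conj_apply y hypos M₂
  rw [← hh₁] at hx'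
  rw [← hh₂] at hy'
  have hP (k : Fin n) : ∑ i, (x i / x k) ^ 2 * ‖M₁ i k‖ ^ 2 =
      ∑ i, (y i / y k) ^ 2 * ‖M₂ i k‖ ^ 2 := by
    have h := congrFun (congrFun heq k) k
    rw [conjTranspose_mul_self_apply_diag, conjTranspose_mul_self_apply_diag,
      Complex.ofReal_inj] at h
    simpa only [hx', hy', norm_mul, Complex.norm_real, mul_pow, Real.norm_eq_abs, sq_abs] using h
  have key (k : Fin n) : (∀ j, j ≠ k → M₁ j k = 0) ∧ (∀ j, j ≠ k → M₂ j k = 0) := by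
    induction k using WellFoundedLT.induction with
    | ind k ih =>
      have hle₁ (i : Fin n) : (x i / x k) ^ 2 * ‖M₁ i k‖ ^ 2 ≤ ‖M₁ i k‖ ^ 2 := by
        rcases lt_or_ge i k with hik | hik
        · simp [row_eq_zero_of_col hM₁ (ih i hik).1 hik.ne']
        · refine mul_le_of_le_one_left (sq_nonneg _) (pow_le_one₀ ?_ ?_)
          · exact (div_pos (hxpos i) (hxpos k)).le
          · exact (div_le_one (hxpos k)).2 (hx.antitone hik)
      have hle₂ (i : Fin n) : ‖M₂ i k‖ ^ 2 ≤ (y i / y k) ^ 2 * ‖M₂ i k‖ ^ 2 := by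
        rcases lt_or_ge i k with hik | hik
        · simp [row_eq_zero_of_col hM₂ (ih i hik).2 hik.ne']
        · exact le_mul_of_one_le_left (sq_nonneg _)
            (one_le_pow₀ ((one_le_div (hypos k)).2 (hy.monotone hik)))
      have hs₁ := Finset.sum_le_sum fun i (_ : i ∈ Finset.univ) => hle₁ i
      have hs₂ := Finset.sum_le_sum fun i (_ : i ∈ Finset.univ) => hle₂ i
      have hc₁ := sum_norm_sq_col_eq_one hM₁ k
      have hc₂ := sum_norm_sq_col_eq_one hM₂ k
      have hPk := hP k
      have hne {z : Fin n → ℝ} (hz : Function.Injective z) (hzpos : ∀ j, 0 < z j) {j : Fin n}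
          (hj : j ≠ k) : (z j / z k) ^ 2 ≠ 1 := by
        rw [Ne, pow_eq_one_iff_of_nonneg (div_pos (hzpos j) (hzpos k)).le two_ne_zero,
          div_eq_one_iff_eq (hzpos k).ne']
        exact hz.ne hj
      refine ⟨fun j hj => ?_, fun j hj => ?_⟩
      · simpa using eq_zero_of_sum_le_sum_mul hle₁ (by linarith) (hne hx.injective hxpos hj)
      · simpa using eq_zero_of_sum_mul_le_sum hle₂ (by linarith) (hne hy.injective hypos hj)
  refine ⟨⟨fun j k hjk => ?_, fun j => ?_⟩, fun j k hjk => ?_, fun j => ?_⟩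
  · rw [hx', (key k).1 j hjk, mul_zero]
  · rw [hx', div_self (hxpos j).ne', Complex.ofReal_one, one_mul]
    exact norm_diag_eq_one_of_col hM₁ (key j).1
  · rw [hy', (key k).2 j hjk, mul_zero]
  · rw [hy', div_self (hypos j).ne', Complex.ofReal_one, one_mul]
    exact norm_diag_eq_one_of_col hM₂ (key j).2
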